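/- For every fixed 1 ≤ i ≤ k, the i-th largest eigenvalue λ_i(A_β) of A_β converges in probability, as β → ∞, to the constant h_i^{(k)}/√(2k), where h_1^{(k)} > ⋯ > h_k^{(k)} are the roots of the k-th Hermite polynomial H_k (orthonormal with respect to the weight e^{−x²} on ℝ). -/

import Mathlib

open MeasureTheory ProbabilityTheory Filter Polynomial Matrix Topology Asymptotics

instance matrixMeasurableSpace {m n α : Type*} [MeasurableSpace α] :
    MeasurableSpace (Matrix m n α) := MeasurableSpace.pi

noncomputable section

/-- The chi distribution with parameter `r`: the measure on `ℝ` with density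
`2^(1-r/2) x^(r-1) e^(-x²/2) / Γ(r/2)` on `(0,∞)`. -/
def chiMeasure (r : ℝ) : Measure ℝ :=
  volume.withDensity fun x => ENNReal.ofReal
    (Set.indicator (Set.Ioi (0:ℝ))
      (fun x => (2:ℝ) ^ (1 - r / 2) * x ^ (r - 1) * Real.exp (-x ^ 2 / 2) / Real.Gamma (r / 2)) x)

/-- The `i`-th largest root of the characteristic polynomial (counted with multiplicity);
for a real symmetric matrix this is its `i`-th largest eigenvalue. -/
def ithLargestEig {n : ℕ} (M : Matrix (Fin n) (Fin n) ℝ) (i : Fin n) : ℝ :=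
  (M.charpoly.roots.sort (· ≤ ·)).getD (n - 1 - (i : ℕ)) 0

def finL {k : ℕ} (l : Fin (k - 1)) : Fin k := ⟨l, by have := l.isLt; omega⟩
def finR {k : ℕ} (l : Fin (k - 1)) : Fin k := ⟨(l : ℕ) + 1, by have := l.isLt; omega⟩

/-- Symmetric tridiagonal matrix with diagonal `d` and off-diagonal `e`. -/
def symTridiagOf {k : ℕ} (d : Fin k → ℝ) (e : Fin (k - 1) → ℝ) : Matrix (Fin k) (Fin k) ℝ :=
  Matrix.of fun i j =>
    if i = j then d i
    else if h : (i : ℕ) + 1 = (j : ℕ) then e ⟨i, by have := j.isLt; omega⟩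
    else if h' : (j : ℕ) + 1 = (i : ℕ) then e ⟨j, by have := i.isLt; omega⟩
    else 0

/-- Lower bidiagonal matrix with diagonal `d` and subdiagonal `e`. -/
def lowerBidiagOf {k : ℕ} (d : Fin k → ℝ) (e : Fin (k - 1) → ℝ) : Matrix (Fin k) (Fin k) ℝ :=
  Matrix.of fun i j =>
    if i = j then d i
    else if h : (j : ℕ) + 1 = (i : ℕ) then e ⟨j, by have := i.isLt; omega⟩
    else 0

/-- The Hermite polynomials, orthonormal with respect to the weight `e^(-x²)` on `ℝ`,
with positive leading coefficients; they satisfy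
`x·H n x = √((n+1)/2)·H (n+1) x + √(n/2)·H (n-1) x`. -/
def Hpoly : ℕ → ℝ → ℝ
  | 0 => fun _ => Real.pi ^ (-(1:ℝ)/4)
  | 1 => fun x => Real.sqrt 2 * x * Real.pi ^ (-(1:ℝ)/4)
  | (n+2) => fun x =>
      (x * Hpoly (n+1) x - Real.sqrt (((n:ℝ)+1)/2) * Hpoly n x) / Real.sqrt (((n:ℝ)+2)/2)

/-- The monic (probabilists') Hermite polynomials:
`He 0 = 1`, `He 1 = X`, `He (n+1) = X·He n - n·He (n-1)`. -/
def heP : ℕ → Polynomial ℝ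
  | 0 => 1
  | 1 => Polynomial.X
  | (n+2) => Polynomial.X * heP (n+1) - Polynomial.C ((n:ℝ)+1) * heP n

/-- The generalized Laguerre polynomials of parameter `γ`, orthonormal with respect to the
weight `x^γ e^(-x)` on `[0,∞)` (formally defined for all real `γ`), with positive leading
coefficients; they satisfy
`x·L n x = √((n+1)(n+γ+1))·L (n+1) x + (2n+γ+1)·L n x + √(n(n+γ))·L (n-1) x`. -/
def Lag (γ : ℝ) : ℕ → ℝ → ℝ
  | 0 => fun _ => Real.Gamma (γ+1) ^ (-(1:ℝ)/2)
  | 1 => fun x => (x - (γ+1)) * Real.Gamma (γ+1) ^ (-(1:ℝ)/2) / Real.sqrt (γ+1)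
  | (n+2) => fun x =>
      ((x - (2*((n:ℝ)+1)+γ+1)) * Lag γ (n+1) x
        - Real.sqrt (((n:ℝ)+1)*(((n:ℝ)+1)+γ)) * Lag γ n x)
      / Real.sqrt (((n:ℝ)+2)*(((n:ℝ)+2)+γ))

/-- The fixed `k×k` symmetric tridiagonal matrix `H` with zero diagonal and off-diagonal
entries `√(k-j)/√2`, `j = 1,…,k-1`. -/
def hermiteH (k : ℕ) : Matrix (Fin k) (Fin k) ℝ :=
  symTridiagOf (fun _ => 0) (fun j => Real.sqrt ((k:ℝ) - 1 - (j:ℕ)) / Real.sqrt 2)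

/-- The fixed `k×k` lower bidiagonal matrix `B_γ` with diagonal `√(γ+k-j)` and
subdiagonal `√(k-j)`. -/
def lagB (k : ℕ) (γ : ℝ) : Matrix (Fin k) (Fin k) ℝ :=
  lowerBidiagOf (fun j => Real.sqrt (γ + (k:ℝ) - 1 - (j:ℕ)))
    (fun j => Real.sqrt ((k:ℝ) - 1 - (j:ℕ)))

/-- The fixed tridiagonal Laguerre matrix `L_γ = B_γ B_γᵀ`. -/
def lagL (k : ℕ) (γ : ℝ) : Matrix (Fin k) (Fin k) ℝ := lagB k γ * (lagB k γ)ᵀ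

/-- Law of the β-Hermite tridiagonal matrix model of size `k`, scaled by `1/√(2kβ)`:
independent `N(0,1)` diagonal entries and `(1/√2)·χ_((k-j)β)` off-diagonal entries. -/
def hermiteLaw (k : ℕ) (β : ℝ) : Measure (Matrix (Fin k) (Fin k) ℝ) :=
  Measure.map (fun p : (Fin k → ℝ) × (Fin (k-1) → ℝ) =>
      (Real.sqrt (2 * (k:ℝ) * β))⁻¹ • symTridiagOf p.1 p.2)
    ((Measure.pi fun _ : Fin k => gaussianReal 0 1).prod
      (Measure.pi fun j : Fin (k-1) =>
        Measure.map (fun x => x / Real.sqrt 2) (chiMeasure (((k:ℝ) - 1 - (j:ℕ)) * β))))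

/-- Law of the limiting symmetric tridiagonal Gaussian matrix `Z` (Hermite case):
i.i.d. `N(0,1)` diagonal entries and i.i.d. `N(0,1/4)` off-diagonal entries. -/
def zLaw (k : ℕ) : Measure (Matrix (Fin k) (Fin k) ℝ) :=
  Measure.map (fun p : (Fin k → ℝ) × (Fin (k-1) → ℝ) => symTridiagOf p.1 p.2)
    ((Measure.pi fun _ : Fin k => gaussianReal 0 1).prod
      (Measure.pi fun _ : Fin (k-1) => gaussianReal 0 (1/4)))

/-- Law of the β-Laguerre matrix model of size `k` with parameter `a`, scaled by `1/(kβ)`: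
`B = (1/(kβ)) X Xᵀ` with `X` lower bidiagonal, `X_jj ~ χ_(2a-β(j-1))`, `X_(j+1,j) ~ χ_(β(k-j))`. -/
def lagLaw (k : ℕ) (β a : ℝ) : Measure (Matrix (Fin k) (Fin k) ℝ) :=
  Measure.map (fun p : (Fin k → ℝ) × (Fin (k-1) → ℝ) =>
      (((k:ℝ) * β)⁻¹) • (lowerBidiagOf p.1 p.2 * (lowerBidiagOf p.1 p.2)ᵀ))
    ((Measure.pi fun j : Fin k => chiMeasure (2 * a - β * (j:ℕ))).prod
      (Measure.pi fun j : Fin (k-1) => chiMeasure (β * ((k:ℝ) - 1 - (j:ℕ)))))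

/-- Law of the limiting lower bidiagonal Gaussian matrix `Z` (Laguerre case):
i.i.d. `N(0,1)` diagonal and subdiagonal entries. -/
def zBidLaw (k : ℕ) : Measure (Matrix (Fin k) (Fin k) ℝ) :=
  Measure.map (fun p : (Fin k → ℝ) × (Fin (k-1) → ℝ) => lowerBidiagOf p.1 p.2)
    ((Measure.pi fun _ : Fin k => gaussianReal 0 1).prod
      (Measure.pi fun _ : Fin (k-1) => gaussianReal 0 1))

/-- `ν` is the centered `k`-variate Gaussian distribution with covariance matrix `S`:
every linear functional has the corresponding one-dimensional centered Gaussian law. -/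
def IsCenteredGaussianVec {k : ℕ} (ν : Measure (Fin k → ℝ)) (S : Fin k → Fin k → ℝ) : Prop :=
  IsProbabilityMeasure ν ∧ ∀ c : Fin k → ℝ,
    Measure.map (fun x => ∑ i, c i * x i) ν =
      gaussianReal 0 (∑ i, ∑ j, c i * c j * S i j).toNNReal

theorem charpoly_roots_of_strictAnti {n : ℕ} (M : Matrix (Fin n) (Fin n) ℝ) (r : Fin n → ℝ)
    (hr : StrictAnti r) (hroot : ∀ i, M.charpoly.IsRoot (r i)) :
    M.charpoly.roots = Finset.univ.val.map r := by
  symm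
  apply Multiset.eq_of_le_of_card_le
  · rw [Multiset.le_iff_subset (Multiset.Nodup.map hr.injective Finset.univ.nodup)]
    intro x hx
    obtain ⟨i, -, rfl⟩ := Multiset.mem_map.1 hx
    exact (mem_roots M.charpoly_monic.ne_zero).2 (hroot i)
  · refine (card_roots' _).trans ?_
    simp [Matrix.charpoly_natDegree_eq_dim]

theorem ithLargestEig_eq_of_strictAnti {n : ℕ} (M : Matrix (Fin n) (Fin n) ℝ) (r : Fin n → ℝ)
    (hr : StrictAnti r) (hroot : ∀ i, M.charpoly.IsRoot (r i)) (i : Fin n) :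
    ithLargestEig M i = r i := by
  have hsort : M.charpoly.roots.sort (· ≤ ·) = List.ofFn (fun j => r j.rev) := by
    rw [charpoly_roots_of_strictAnti M r hr hroot]
    refine List.Perm.eq_of_pairwise' (r := (· ≤ ·)) (Multiset.pairwise_sort _ _) ?_ ?_
    · rw [List.pairwise_ofFn]
      intro a b hab
      exact (hr (Fin.rev_lt_rev.2 hab)).le
    · rw [← Multiset.coe_eq_coe, Multiset.sort_eq]
      have h1 : (Finset.univ : Finset (Fin n)).val.map r
          = ((Finset.univ : Finset (Fin n)).val.map Fin.rev).map r := by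
        congr 1
        exact (congrArg Finset.val (Finset.map_univ_equiv (Fin.revPerm (n := n)))).symm
      rw [h1, Multiset.map_map, Fin.univ_val_map]
      rfl
  have hi := i.isLt
  have hlt : n - 1 - (i : ℕ) < n := by omega
  unfold ithLargestEig
  rw [hsort, List.getD_eq_getElem _ _ (by simpa using hlt), List.getElem_ofFn]
  congr 1
  ext
  simp only [Fin.val_rev]
  omega

theorem eval_charpoly_of_strictAnti {n : ℕ} (M : Matrix (Fin n) (Fin n) ℝ) (r : Fin n → ℝ)
    (hr : StrictAnti r) (hroot : ∀ i, M.charpoly.IsRoot (r i)) (x : ℝ) :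
    M.charpoly.eval x = ∏ j, (x - r j) := by
  have hroots := charpoly_roots_of_strictAnti M r hr hroot
  have h := prod_multiset_X_sub_C_of_monic_of_roots_card_eq M.charpoly_monic
    (by rw [hroots]; simp [Matrix.charpoly_natDegree_eq_dim])
  rw [← h, hroots, Multiset.map_map]
  change (∏ j, (X - C (r j))).eval x = _
  simp [eval_prod]

theorem continuous_eval_charpoly {n : ℕ} (x : ℝ) :
    Continuous fun M : Matrix (Fin n) (Fin n) ℝ => M.charpoly.eval x := by
  simp only [Matrix.eval_charpoly]
  exact (continuous_const.sub continuous_id).matrix_det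

/-- Simple real spectra are continuous: near a matrix whose characteristic polynomial has `n`
distinct real roots, the ordered eigenvalues are close to these roots. -/
theorem eventually_abs_ithLargestEig_sub_le {n : ℕ} (M : Matrix (Fin n) (Fin n) ℝ) (r : Fin n → ℝ)
    (hr : StrictAnti r) (hroot : ∀ i, M.charpoly.IsRoot (r i)) {ε : ℝ} (hε : 0 < ε) :
    ∀ᶠ A in 𝓝 M, ∀ i, |ithLargestEig A i - r i| ≤ ε := by
  obtain ⟨t, ht0, htε, htgap⟩ : ∃ t : ℝ, 0 < t ∧ t < ε ∧ ∀ i j, i < j → 2 * t < r i - r j := by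
    have h1 : ∀ᶠ t : ℝ in 𝓝[>] 0, 0 < t := self_mem_nhdsWithin
    have h2 : ∀ᶠ t : ℝ in 𝓝[>] 0, t < ε := (eventually_lt_nhds hε).filter_mono nhdsWithin_le_nhds
    have h3 : ∀ᶠ t : ℝ in 𝓝[>] 0, ∀ i j, i < j → 2 * t < r i - r j := by
      refine eventually_all.2 fun i => eventually_all.2 fun j => ?_
      by_cases hij : i < j
      · have hpos : 0 < (r i - r j) / 2 := by linarith [hr hij]
        filter_upwards [(eventually_lt_nhds hpos).filter_mono nhdsWithin_le_nhds] with t ht _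
        linarith
      · exact Eventually.of_forall fun t h => absurd h hij
    obtain ⟨t, h⟩ := (h1.and (h2.and h3)).exists
    exact ⟨t, h⟩
  have hsign : ∀ i, ∀ᶠ A in 𝓝 M,
      A.charpoly.eval (r i - t) * A.charpoly.eval (r i + t) < 0 := by
    intro i
    have hcont : Continuous fun A : Matrix (Fin n) (Fin n) ℝ =>
        A.charpoly.eval (r i - t) * A.charpoly.eval (r i + t) :=
      (continuous_eval_charpoly _).mul (continuous_eval_charpoly _)
    refine hcont.continuousAt.eventually_lt continuousAt_const ?_
    rw [eval_charpoly_of_strictAnti M r hr hroot, eval_charpoly_of_strictAnti M r hr hroot,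
      ← Finset.prod_mul_distrib, ← Finset.mul_prod_erase _ _ (Finset.mem_univ i)]
    refine mul_neg_of_neg_of_pos (by nlinarith) (Finset.prod_pos fun j hj => ?_)
    rcases lt_or_gt_of_ne (Finset.ne_of_mem_erase hj) with hji | hij
    · have := htgap _ _ hji
      exact mul_pos_of_neg_of_neg (by linarith) (by linarith)
    · have := htgap _ _ hij
      exact mul_pos (by linarith) (by linarith)
  filter_upwards [eventually_all.2 hsign] with A hA
  have hex : ∀ i, ∃ x ∈ Set.Icc (r i - t) (r i + t), A.charpoly.IsRoot x := by
    intro i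
    have hiv := intermediate_value_uIcc (a := r i - t) (b := r i + t)
      (f := fun x => A.charpoly.eval x) A.charpoly.continuous.continuousOn
    have h0 : (0 : ℝ) ∈ Set.uIcc (A.charpoly.eval (r i - t)) (A.charpoly.eval (r i + t)) := by
      rw [Set.mem_uIcc]
      rcases mul_neg_iff.1 (hA i) with h | h
      · exact Or.inr ⟨h.2.le, h.1.le⟩
      · exact Or.inl ⟨h.1.le, h.2.le⟩
    obtain ⟨x, hx, hx0⟩ := hiv h0
    rw [Set.uIcc_of_le (by linarith)] at hx
    exact ⟨x, hx, hx0⟩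
  choose s hs hs0 using hex
  have hsanti : StrictAnti s := fun i j hij => by
    linarith [htgap i j hij, (hs i).1, (hs j).2]
  intro i
  rw [ithLargestEig_eq_of_strictAnti A s hsanti hs0, abs_le]
  constructor <;> linarith [(hs i).1, (hs i).2]

theorem symTridiagOf_mulVec {k : ℕ} (d : Fin k → ℝ) (e v : ℕ → ℝ) (i : Fin k) :
    (symTridiagOf d (fun j => e j) *ᵥ fun j : Fin k => v j) i =
      d i * v i + (if (i : ℕ) + 1 < k then e i * v (i + 1) else 0)
        + (if 0 < (i : ℕ) then e (i - 1) * v (i - 1) else 0) := by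
  obtain ⟨i, hi⟩ := i
  have hentry : ∀ j : Fin k, symTridiagOf d (fun j => e j) ⟨i, hi⟩ j * v j =
      (if i = j then d ⟨i, hi⟩ * v i else 0) + (if i + 1 = j then e i * v (i + 1) else 0)
        + (if (j : ℕ) = i - 1 then (if 0 < i then e (i - 1) * v (i - 1) else 0) else 0) := by
    rintro ⟨j, hj⟩
    simp only [symTridiagOf, Matrix.of_apply, Fin.mk.injEq]
    by_cases h1 : i = j
    · subst h1
      have : ¬ (i = i - 1 ∧ 0 < i) := by omega
      by_cases h2 : i = i - 1
      · have h3 : ¬ 0 < i := by omega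
        simp [h3]
      · simp [h2]
    · by_cases h2 : i + 1 = j
      · subst h2
        have h3 : ¬ i + 1 = i - 1 := by omega
        simp [h3]
      · by_cases h3 : j + 1 = i
        · subst h3
          have h4 : ¬ j + 1 + 1 = j := by omega
          simp [h4]
        · by_cases h4 : j = i - 1
          · have h5 : ¬ 0 < i := by omega
            simp [h1, h2, h3, h5]
          · simp [h1, h2, h3, h4]
  simp only [Matrix.mulVec, dotProduct]
  rw [Finset.sum_congr rfl fun j _ => hentry j,
    Fin.sum_univ_eq_sum_range (fun j => (if i = j then d ⟨i, hi⟩ * v i else 0)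
      + (if i + 1 = j then e i * v (i + 1) else 0)
      + (if j = i - 1 then (if 0 < i then e (i - 1) * v (i - 1) else 0) else 0)) k,
    Finset.sum_add_distrib, Finset.sum_add_distrib, Finset.sum_ite_eq, Finset.sum_ite_eq,
    Finset.sum_ite_eq']
  have h1 : i - 1 < k := by omega
  simp [hi, h1]

theorem Hpoly_zero_ne_zero (x : ℝ) : Hpoly 0 x ≠ 0 := by
  simp only [Hpoly]
  positivity

theorem Hpoly_recurrence_one (x : ℝ) : Real.sqrt (1 / 2) * Hpoly 1 x = x * Hpoly 0 x := by
  simp only [Hpoly]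
  have : Real.sqrt (1 / 2) * Real.sqrt 2 = 1 := by
    rw [← Real.sqrt_mul (by norm_num)]
    norm_num
  linear_combination x * Real.pi ^ (-(1:ℝ)/4) * this

theorem Hpoly_recurrence (n : ℕ) (x : ℝ) :
    Real.sqrt (((n:ℝ) + 2) / 2) * Hpoly (n + 2) x + Real.sqrt (((n:ℝ) + 1) / 2) * Hpoly n x
      = x * Hpoly (n + 1) x := by
  have hpos : 0 < Real.sqrt (((n:ℝ) + 2) / 2) := Real.sqrt_pos.2 (by positivity)
  rw [show Hpoly (n + 2) x = (x * Hpoly (n+1) x - Real.sqrt (((n:ℝ)+1)/2) * Hpoly n x)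
    / Real.sqrt (((n:ℝ)+2)/2) from rfl]
  field_simp
  ring

theorem hermiteH_mulVec {k : ℕ} {x : ℝ} (hx : Hpoly k x = 0) :
    (hermiteH k *ᵥ fun j : Fin k => Hpoly (k - 1 - j) x)
      = x • fun j : Fin k => Hpoly (k - 1 - j) x := by
  ext i
  rw [hermiteH, symTridiagOf_mulVec (fun _ => 0)
    (fun j => Real.sqrt ((k:ℝ) - 1 - j) / Real.sqrt 2) (fun j => Hpoly (k - 1 - j) x) i]
  obtain ⟨i, hi⟩ := i
  obtain ⟨m, rfl⟩ : ∃ m, k = i + m + 1 := ⟨k - i - 1, by omega⟩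
  have hupper : (if 0 < i then Real.sqrt (((i + m + 1 : ℕ) : ℝ) - 1 - ((i - 1 : ℕ) : ℝ))
        / Real.sqrt 2 * Hpoly (i + m + 1 - 1 - (i - 1)) x else 0)
      = Real.sqrt (((m : ℝ) + 1) / 2) * Hpoly (m + 1) x := by
    rcases Nat.eq_zero_or_pos i with rfl | hpos
    · simp only [zero_add] at hx
      simp [hx]
    · obtain ⟨i, rfl⟩ : ∃ i', i = i' + 1 := ⟨i - 1, by omega⟩
      rw [if_pos hpos, ← Real.sqrt_div' _ (by norm_num)]
      congr 2
      · push_cast [Nat.add_sub_cancel]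
        ring_nf
      · omega
  simp only [Pi.smul_apply, smul_eq_mul]
  rw [hupper, show i + m + 1 - 1 - i = m by omega]
  cases m with
  | zero =>
    have := Hpoly_recurrence_one x
    simp at this ⊢
    linarith
  | succ m =>
    rw [if_pos (by omega), ← Real.sqrt_div' _ (by norm_num),
      show i + (m + 1) + 1 - 1 - (i + 1) = m by omega, ← Hpoly_recurrence m x]
    push_cast
    ring_nf

theorem isRoot_charpoly_of_mulVec {k : ℕ} (M : Matrix (Fin k) (Fin k) ℝ) {v : Fin k → ℝ}
    (hv : v ≠ 0) {μ : ℝ} (h : M *ᵥ v = μ • v) : M.charpoly.IsRoot μ := by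
  rw [IsRoot, Matrix.eval_charpoly, ← Matrix.exists_mulVec_eq_zero_iff]
  refine ⟨v, hv, ?_⟩
  rw [Matrix.sub_mulVec, h, Matrix.scalar_apply, ← Matrix.smul_one_eq_diagonal,
    Matrix.smul_mulVec, Matrix.one_mulVec, sub_self]

theorem isRoot_charpoly_smul_hermiteH {k : ℕ} (hk : 1 ≤ k) {x : ℝ} (hx : Hpoly k x = 0) (c : ℝ) :
    (c • hermiteH k).charpoly.IsRoot (c * x) := by
  refine isRoot_charpoly_of_mulVec _ (v := fun j : Fin k => Hpoly (k - 1 - j) x) ?_ ?_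
  · intro h
    have := congrFun h ⟨k - 1, by omega⟩
    simp only [Nat.sub_self, Pi.zero_apply] at this
    exact Hpoly_zero_ne_zero x this
  · rw [Matrix.smul_mulVec, hermiteH_mulVec hx, smul_smul]

/-- The density of the chi distribution with parameter `r`, multiplied by `x ^ s`. -/
def chiMomentDensity (r s x : ℝ) : ℝ :=
  (2:ℝ) ^ (1 - r / 2) / Real.Gamma (r / 2)
    * (x ^ (r - 1 + s) * Real.exp (-(1/2) * x ^ (2:ℝ)))

theorem integrableOn_chiMomentDensity {r s : ℝ} (hr : 0 < r) (hs : 0 ≤ s) :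
    IntegrableOn (chiMomentDensity r s) (Set.Ioi 0) :=
  (integrableOn_rpow_mul_exp_neg_mul_rpow (by linarith) two_pos (by norm_num)).const_mul _

theorem integral_chiMomentDensity {r s : ℝ} (hr : 0 < r) (hs : 0 ≤ s) :
    ∫ x in Set.Ioi (0:ℝ), chiMomentDensity r s x
      = 2 ^ (s / 2) * Real.Gamma (r / 2 + s / 2) / Real.Gamma (r / 2) := by
  simp only [chiMomentDensity]
  rw [integral_const_mul, integral_rpow_mul_exp_neg_mul_rpow two_pos (by linarith) (by norm_num),
    show (r - 1 + s + 1) / 2 = r / 2 + s / 2 by ring,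
    show (-(r - 1 + s + 1)) / 2 = -(r / 2 + s / 2) by ring, one_div,
    Real.inv_rpow zero_le_two, Real.rpow_neg zero_le_two, inv_inv, div_mul_eq_mul_div]
  have h2 : (2:ℝ) ^ (1 - r / 2) * 2 ^ (r / 2 + s / 2) = 2 * 2 ^ (s / 2) := by
    rw [← Real.rpow_add two_pos, ← Real.rpow_one_add' zero_le_two (by positivity)]
    ring_nf
  congr 1
  linear_combination Real.Gamma (r / 2 + s / 2) / 2 * h2

theorem lintegral_chiMeasure (r : ℝ) {f : ℝ → ℝ} (hf : Measurable f) :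
    ∫⁻ x, ENNReal.ofReal (f x) ∂chiMeasure r =
      ∫⁻ x in Set.Ioi (0:ℝ), ENNReal.ofReal ((2:ℝ) ^ (1 - r / 2) * x ^ (r - 1)
        * Real.exp (-x ^ 2 / 2) / Real.Gamma (r / 2)) * ENNReal.ofReal (f x) := by
  have hm : Measurable fun x : ℝ =>
      (2:ℝ) ^ (1 - r / 2) * x ^ (r - 1) * Real.exp (-x ^ 2 / 2) / Real.Gamma (r / 2) := by
    fun_prop
  rw [chiMeasure, lintegral_withDensity_eq_lintegral_mul _
    (hm.indicator measurableSet_Ioi).ennreal_ofReal hf.ennreal_ofReal,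
    ← lintegral_indicator measurableSet_Ioi]
  refine lintegral_congr fun x => ?_
  by_cases hx : x ∈ Set.Ioi (0:ℝ) <;> simp [hx]

theorem chiMeasure_density_mul_rpow {r x : ℝ} (hx : 0 < x) (s : ℝ) :
    (2:ℝ) ^ (1 - r / 2) * x ^ (r - 1) * Real.exp (-x ^ 2 / 2) / Real.Gamma (r / 2) * x ^ s =
      chiMomentDensity r s x := by
  rw [chiMomentDensity, Real.rpow_add hx, Real.rpow_two, show -(1/2) * x ^ 2 = -x ^ 2 / 2 by ring]
  ring

theorem chiMeasure_density_nonneg {r x : ℝ} (hr : 0 < r) (hx : 0 < x) :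
    0 ≤ (2:ℝ) ^ (1 - r / 2) * x ^ (r - 1) * Real.exp (-x ^ 2 / 2) / Real.Gamma (r / 2) := by
  have := Real.Gamma_pos_of_pos (half_pos hr)
  positivity

theorem isProbabilityMeasure_chiMeasure {r : ℝ} (hr : 0 < r) :
    IsProbabilityMeasure (chiMeasure r) := by
  constructor
  have h := lintegral_chiMeasure r (f := fun _ => 1) measurable_const
  have hG := (Real.Gamma_pos_of_pos (half_pos hr)).ne'
  rw [← lintegral_one]
  simp only [ENNReal.ofReal_one, mul_one] at h
  rw [h]
  have hcongr : ∀ x ∈ Set.Ioi (0:ℝ),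
      (2:ℝ) ^ (1 - r / 2) * x ^ (r - 1) * Real.exp (-x ^ 2 / 2) / Real.Gamma (r / 2)
        = chiMomentDensity r 0 x := fun x hx => by
    rw [← chiMeasure_density_mul_rpow hx 0, Real.rpow_zero, mul_one]
  rw [setLIntegral_congr_fun measurableSet_Ioi fun x hx => congrArg ENNReal.ofReal (hcongr x hx),
    ← ofReal_integral_eq_lintegral_ofReal (integrableOn_chiMomentDensity hr le_rfl),
    integral_chiMomentDensity hr le_rfl]
  · simp [hG]
  · filter_upwards [ae_restrict_mem measurableSet_Ioi] with x hx
    rw [← hcongr x hx]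
    exact chiMeasure_density_nonneg hr hx

/-- The variance of the square of a chi variable, `E (χ_r² - r)² = 2r`. -/
theorem lintegral_sq_sub_sq_chiMeasure {r : ℝ} (hr : 0 < r) :
    ∫⁻ x, ENNReal.ofReal ((x ^ 2 - r) ^ 2) ∂chiMeasure r = ENNReal.ofReal (2 * r) := by
  have hG := (Real.Gamma_pos_of_pos (half_pos hr)).ne'
  have i0 := integrableOn_chiMomentDensity hr (s := 0) le_rfl
  have i2 := integrableOn_chiMomentDensity hr (s := 2) zero_le_two
  have i4 := integrableOn_chiMomentDensity hr (s := 4) zero_le_four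
  rw [lintegral_chiMeasure r (by fun_prop)]
  have hcongr : ∀ x ∈ Set.Ioi (0:ℝ), ENNReal.ofReal ((2:ℝ) ^ (1 - r / 2) * x ^ (r - 1)
        * Real.exp (-x ^ 2 / 2) / Real.Gamma (r / 2)) * ENNReal.ofReal ((x ^ 2 - r) ^ 2)
      = ENNReal.ofReal (chiMomentDensity r 4 x
        - (2 * r) * (chiMomentDensity r 2 x)
        + r ^ 2 * (chiMomentDensity r 0 x)) := fun x hx => by
    rw [← ENNReal.ofReal_mul (chiMeasure_density_nonneg hr hx),
      ← chiMeasure_density_mul_rpow hx, ← chiMeasure_density_mul_rpow hx,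
      ← chiMeasure_density_mul_rpow hx, Real.rpow_zero, Real.rpow_two,
      show (4:ℝ) = ((4:ℕ):ℝ) by norm_num, Real.rpow_natCast]
    congr 1
    ring
  have hnonneg : ∀ x ∈ Set.Ioi (0:ℝ), 0 ≤ chiMomentDensity r 4 x
        - (2 * r) * (chiMomentDensity r 2 x)
        + r ^ 2 * (chiMomentDensity r 0 x) := fun x hx => by
    rw [← chiMeasure_density_mul_rpow hx, ← chiMeasure_density_mul_rpow hx,
      ← chiMeasure_density_mul_rpow hx, Real.rpow_zero, Real.rpow_two,
      show (4:ℝ) = ((4:ℕ):ℝ) by norm_num, Real.rpow_natCast]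
    have := mul_nonneg (chiMeasure_density_nonneg hr hx) (sq_nonneg (x ^ 2 - r))
    linarith
  have i42 : Integrable (fun x => chiMomentDensity r 4 x - (2 * r) * chiMomentDensity r 2 x)
      (volume.restrict (Set.Ioi 0)) := i4.sub (i2.const_mul _)
  have i420 : Integrable (fun x => chiMomentDensity r 4 x - (2 * r) * chiMomentDensity r 2 x
      + r ^ 2 * chiMomentDensity r 0 x) (volume.restrict (Set.Ioi 0)) := i42.add (i0.const_mul _)
  rw [setLIntegral_congr_fun measurableSet_Ioi hcongr,
    ← ofReal_integral_eq_lintegral_ofReal i420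
      ((ae_restrict_iff' measurableSet_Ioi).2 (Eventually.of_forall hnonneg)),
    integral_add i42 (i0.const_mul _), integral_sub i4 (i2.const_mul _),
    integral_const_mul, integral_const_mul, integral_chiMomentDensity hr le_rfl,
    integral_chiMomentDensity hr zero_le_two, integral_chiMomentDensity hr zero_le_four]
  congr 1
  have g1 : Real.Gamma (r / 2 + 2 / 2) = r / 2 * Real.Gamma (r / 2) := by
    rw [show (2:ℝ) / 2 = 1 by norm_num, Real.Gamma_add_one (half_pos hr).ne']
  have g2 : Real.Gamma (r / 2 + 4 / 2) = (r / 2 + 1) * (r / 2 * Real.Gamma (r / 2)) := by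
    rw [show r / 2 + (4:ℝ) / 2 = (r / 2 + 1) + 1 by ring, Real.Gamma_add_one (by positivity),
      Real.Gamma_add_one (half_pos hr).ne']
  rw [g1, g2, zero_div, add_zero, Real.rpow_zero, show (2:ℝ) / 2 = 1 by norm_num,
    show (4:ℝ) / 2 = 2 by norm_num, Real.rpow_one, Real.rpow_two]
  field_simp
  ring

theorem chiMeasure_Iic_zero (r : ℝ) : chiMeasure r (Set.Iic 0) = 0 := by
  rw [chiMeasure, withDensity_apply _ measurableSet_Iic]
  refine (setLIntegral_congr_fun (g := 0) measurableSet_Iic fun x hx => ?_).trans (by simp)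
  rw [Set.indicator_of_notMem (by simpa using hx)]
  simp

/-- A chi variable with large parameter `r` concentrates around `√r`. -/
theorem chiMeasure_abs_sub_sqrt_le {r : ℝ} (hr : 0 < r) {η : ℝ} (hη : 0 < η) :
    chiMeasure r {x | η * Real.sqrt r ≤ |x - Real.sqrt r|} ≤ ENNReal.ofReal (2 / (η ^ 2 * r)) := by
  have hsub : {x | η * Real.sqrt r ≤ |x - Real.sqrt r|} ⊆
      Set.Iic 0 ∪ {x | ENNReal.ofReal ((η * r) ^ 2) ≤ ENNReal.ofReal ((x ^ 2 - r) ^ 2)} := by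
    intro x hx
    rcases le_or_gt x 0 with h0 | h0
    · exact Or.inl h0
    · right
      have hs : 0 < Real.sqrt r := Real.sqrt_pos.2 hr
      have hsq : Real.sqrt r * Real.sqrt r = r := Real.mul_self_sqrt hr.le
      refine ENNReal.ofReal_le_ofReal ?_
      rw [← sq_abs (x ^ 2 - r)]
      refine pow_le_pow_left₀ (by positivity) ?_ 2
      calc η * r = η * Real.sqrt r * Real.sqrt r := by rw [mul_assoc, hsq]
        _ ≤ |x - Real.sqrt r| * (x + Real.sqrt r) :=
          mul_le_mul hx (by linarith) hs.le (abs_nonneg _)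
        _ = |x ^ 2 - r| := by
          rw [← abs_of_pos (show 0 < x + Real.sqrt r by positivity), ← abs_mul]
          congr 1
          linear_combination -hsq
  have hpos : 0 < (η * r) ^ 2 := by positivity
  have hmarkov := meas_ge_le_lintegral_div (μ := chiMeasure r)
    (f := fun x => ENNReal.ofReal ((x ^ 2 - r) ^ 2)) (by fun_prop)
    (ENNReal.ofReal_pos.2 hpos).ne' ENNReal.ofReal_ne_top
  calc _ ≤ _ := measure_mono hsub
    _ ≤ _ := measure_union_le _ _
    _ ≤ ENNReal.ofReal (2 / (η ^ 2 * r)) := by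
      rw [chiMeasure_Iic_zero, zero_add]
      refine hmarkov.trans_eq ?_
      rw [lintegral_sq_sub_sq_chiMeasure hr, ← ENNReal.ofReal_div_of_pos hpos]
      congr 1
      field_simp

theorem tendsto_gaussianReal_abs_mul_ge {c : ℝ → ℝ} (hc : Tendsto c atTop (𝓝 0)) {δ : ℝ}
    (hδ : 0 < δ) :
    Tendsto (fun β => gaussianReal 0 1 {x | δ ≤ |c β * x|}) atTop (𝓝 0) := by
  have hlim : Tendsto (fun β => ENNReal.ofReal ((c β) ^ 2 / δ ^ 2)) atTop (𝓝 0) := by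
    have := ENNReal.tendsto_ofReal ((hc.pow 2).div_const (δ ^ 2))
    simpa using this
  refine tendsto_of_tendsto_of_tendsto_of_le_of_le tendsto_const_nhds hlim
    (fun _ => zero_le) fun β => ?_
  have hL : MemLp (fun x : ℝ => c β * x) 2 (gaussianReal 0 1) :=
    (memLp_id_gaussianReal 2).const_mul (c β)
  have h := meas_ge_le_variance_div_sq hL hδ
  rw [integral_const_mul, integral_id_gaussianReal, mul_zero, variance_const_mul,
    variance_fun_id_gaussianReal] at h
  simpa using h

theorem measurable_symTridiagOf {k : ℕ} :
    Measurable fun p : (Fin k → ℝ) × (Fin (k - 1) → ℝ) => symTridiagOf p.1 p.2 := by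
  refine measurable_pi_iff.2 fun i => measurable_pi_iff.2 fun j => ?_
  simp only [symTridiagOf, Matrix.of_apply]
  split_ifs <;> fun_prop

theorem measurable_smul_symTridiagOf {k : ℕ} (c : ℝ) :
    Measurable fun p : (Fin k → ℝ) × (Fin (k - 1) → ℝ) => c • symTridiagOf p.1 p.2 := by
  refine measurable_pi_iff.2 fun i => measurable_pi_iff.2 fun j => ?_
  exact ((measurable_pi_iff.1 (measurable_pi_iff.1 measurable_symTridiagOf i) j)).const_mul c

theorem abs_smul_symTridiagOf_sub_lt {k : ℕ} {d d' : Fin k → ℝ} {e e' : Fin (k - 1) → ℝ}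
    {c c' δ : ℝ} (hδ : 0 < δ) (hd : ∀ i, |c * d i - c' * d' i| < δ)
    (he : ∀ l, |c * e l - c' * e' l| < δ) (i j : Fin k) :
    |(c • symTridiagOf d e) i j - (c' • symTridiagOf d' e') i j| < δ := by
  simp only [Matrix.smul_apply, symTridiagOf, Matrix.of_apply, smul_eq_mul]
  split_ifs
  · exact hd i
  · exact he _
  · exact he _
  · simpa using hδ

theorem tendsto_map_chiMeasure_abs_sub_ge {k : ℕ} {δ : ℝ} (hδ : 0 < δ) (l : Fin (k - 1)) :
    Tendsto (fun β : ℝ => Measure.map (fun x => x / Real.sqrt 2)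
        (chiMeasure (((k:ℝ) - 1 - (l:ℕ)) * β))
        {x | δ ≤ |(Real.sqrt (2 * (k:ℝ) * β))⁻¹ * x
          - (Real.sqrt (2 * (k:ℝ)))⁻¹ * (Real.sqrt ((k:ℝ) - 1 - (l:ℕ)) / Real.sqrt 2)|})
      atTop (𝓝 0) := by
  obtain ⟨m, hm⟩ : ∃ m : ℝ, (k:ℝ) - 1 - (l:ℕ) = m := ⟨_, rfl⟩
  have hlt : ((l:ℕ):ℝ) + 1 < k := by
    have := l.isLt
    exact_mod_cast (by omega : (l:ℕ) + 1 < k)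
  have hm0 : 0 < m := by linarith
  have hk0 : (0:ℝ) < k := by linarith [(l:ℕ).cast_nonneg (α := ℝ)]
  rw [hm]
  set b : ℝ := (Real.sqrt (2 * (k:ℝ)))⁻¹ * (Real.sqrt m / Real.sqrt 2) with hb
  have hb0 : 0 < b := by positivity
  have hlim : Tendsto (fun β : ℝ => ENNReal.ofReal (2 / ((δ / b) ^ 2 * (m * β)))) atTop (𝓝 0) := by
    rw [← ENNReal.ofReal_zero]
    refine ENNReal.tendsto_ofReal (tendsto_const_nhds.div_atTop ?_)
    exact (tendsto_id.const_mul_atTop hm0).const_mul_atTop (by positivity)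
  refine tendsto_of_tendsto_of_tendsto_of_le_of_le' tendsto_const_nhds hlim
    (Eventually.of_forall fun _ => zero_le) ?_
  filter_upwards [eventually_gt_atTop 0] with β hβ
  rw [Measure.map_apply (by fun_prop) (measurableSet_le (by fun_prop) (by fun_prop))]
  refine (measure_mono fun x hx => ?_).trans
    (chiMeasure_abs_sub_sqrt_le (mul_pos hm0 hβ) (div_pos hδ hb0))
  simp only [Set.mem_preimage, Set.mem_ofPred_eq] at hx ⊢
  have hs : 0 < Real.sqrt (m * β) := Real.sqrt_pos.2 (mul_pos hm0 hβ)
  have key : (Real.sqrt (2 * (k:ℝ) * β))⁻¹ * (x / Real.sqrt 2) - b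
      = b / Real.sqrt (m * β) * (x - Real.sqrt (m * β)) := by
    have h1 : 0 < Real.sqrt β := Real.sqrt_pos.2 hβ
    have h2 : 0 < Real.sqrt m := Real.sqrt_pos.2 hm0
    have h3 : 0 < Real.sqrt (2 * (k:ℝ)) := Real.sqrt_pos.2 (by positivity)
    rw [hb, Real.sqrt_mul hm0.le, Real.sqrt_mul (by positivity) β]
    field_simp
  rw [key, abs_mul, abs_of_pos (div_pos hb0 hs)] at hx
  calc δ / b * Real.sqrt (m * β)
      ≤ (b / Real.sqrt (m * β) * |x - Real.sqrt (m * β)|) / b * Real.sqrt (m * β) := by gcongr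
    _ = |x - Real.sqrt (m * β)| := by field_simp

theorem hermiteLaw_le {k : ℕ} {β δ : ℝ} (hβ : 0 < β) (hδ : 0 < δ)
    {S : Set (Matrix (Fin k) (Fin k) ℝ)}
    (hS : ∀ A ∈ S, ∃ i j, δ ≤ |A i j - ((Real.sqrt (2 * (k:ℝ)))⁻¹ • hermiteH k) i j|) :
    hermiteLaw k β S ≤
      ∑ _i : Fin k, gaussianReal 0 1 {x | δ ≤ |(Real.sqrt (2 * (k:ℝ) * β))⁻¹ * x|} +
      ∑ l : Fin (k - 1), Measure.map (fun x => x / Real.sqrt 2)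
        (chiMeasure (((k:ℝ) - 1 - (l:ℕ)) * β))
        {x | δ ≤ |(Real.sqrt (2 * (k:ℝ) * β))⁻¹ * x
          - (Real.sqrt (2 * (k:ℝ)))⁻¹ * (Real.sqrt ((k:ℝ) - 1 - (l:ℕ)) / Real.sqrt 2)|} := by
  have hprob : ∀ l : Fin (k - 1), IsProbabilityMeasure (Measure.map (fun x => x / Real.sqrt 2)
      (chiMeasure (((k:ℝ) - 1 - (l:ℕ)) * β))) := fun l => by
    have hlt : ((l:ℕ):ℝ) + 1 < k := by
      have := l.isLt
      exact_mod_cast (by omega : (l:ℕ) + 1 < k)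
    have := isProbabilityMeasure_chiMeasure (mul_pos (by linarith : 0 < (k:ℝ) - 1 - (l:ℕ)) hβ)
    exact Measure.isProbabilityMeasure_map (by fun_prop)
  set V : Set (Matrix (Fin k) (Fin k) ℝ) :=
    ⋃ i, ⋃ j, {A | δ ≤ |A i j - ((Real.sqrt (2 * (k:ℝ)))⁻¹ • hermiteH k) i j|} with hV
  have hentry : ∀ i j, Measurable fun A : Matrix (Fin k) (Fin k) ℝ => A i j := fun i j =>
    (measurable_pi_apply j).comp (measurable_pi_apply i)
  have hVm : MeasurableSet V :=
    MeasurableSet.iUnion fun i => MeasurableSet.iUnion fun j =>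
      measurableSet_le measurable_const ((hentry i j).sub_const _).abs
  have hSV : S ⊆ V := fun A hA => by
    obtain ⟨i, j, hij⟩ := hS A hA
    exact Set.mem_iUnion.2 ⟨i, Set.mem_iUnion.2 ⟨j, hij⟩⟩
  refine (measure_mono hSV).trans ?_
  rw [hermiteLaw, Measure.map_apply (measurable_smul_symTridiagOf _) hVm]
  set P := (Measure.pi fun _ : Fin k => gaussianReal 0 1).prod
      (Measure.pi fun j : Fin (k-1) =>
        Measure.map (fun x => x / Real.sqrt 2) (chiMeasure (((k:ℝ) - 1 - (j:ℕ)) * β))) with hP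
  have hfst : ∀ i : Fin k, P ((fun p => p.1 i) ⁻¹' {x | δ ≤ |(Real.sqrt (2 * (k:ℝ) * β))⁻¹ * x|})
      = gaussianReal 0 1 {x | δ ≤ |(Real.sqrt (2 * (k:ℝ) * β))⁻¹ * x|} := fun i =>
    ((measurePreserving_eval _ i).comp measurePreserving_fst).measure_preimage
      (measurableSet_le (by fun_prop) (by fun_prop)).nullMeasurableSet
  have hsnd : ∀ l : Fin (k - 1), P ((fun p => p.2 l) ⁻¹' {x | δ ≤ |(Real.sqrt (2 * (k:ℝ) * β))⁻¹ * x
          - (Real.sqrt (2 * (k:ℝ)))⁻¹ * (Real.sqrt ((k:ℝ) - 1 - (l:ℕ)) / Real.sqrt 2)|})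
      = Measure.map (fun x => x / Real.sqrt 2) (chiMeasure (((k:ℝ) - 1 - (l:ℕ)) * β))
        {x | δ ≤ |(Real.sqrt (2 * (k:ℝ) * β))⁻¹ * x
          - (Real.sqrt (2 * (k:ℝ)))⁻¹ * (Real.sqrt ((k:ℝ) - 1 - (l:ℕ)) / Real.sqrt 2)|} :=
    fun l => ((measurePreserving_eval _ l).comp measurePreserving_snd).measure_preimage
      (measurableSet_le (by fun_prop) (by fun_prop)).nullMeasurableSet
  rw [← Finset.sum_congr rfl fun i _ => hfst i, ← Finset.sum_congr rfl fun l _ => hsnd l]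
  refine (measure_mono ?_).trans ((measure_union_le _ _).trans
    (add_le_add (measure_iUnion_fintype_le _ _) (measure_iUnion_fintype_le _ _)))
  intro p hp
  by_contra hcon
  simp only [Set.mem_union, Set.mem_iUnion, Set.mem_preimage, Set.mem_ofPred_eq, not_or,
    not_exists, not_le] at hcon
  obtain ⟨i, hi⟩ := Set.mem_iUnion.1 hp
  obtain ⟨j, hij⟩ := Set.mem_iUnion.1 hi
  refine (abs_smul_symTridiagOf_sub_lt hδ (fun i => ?_) hcon.2 i j).not_ge hij
  simpa using hcon.1 i

theorem hermite_eig_tendsto_root (k : ℕ) (hk : 1 ≤ k)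
    (h : Fin k → ℝ) (hanti : StrictAnti h) (hroot : ∀ i, Hpoly k (h i) = 0)
    (i : Fin k) (ε : ℝ) (hε : 0 < ε) :
    Tendsto (fun β : ℝ =>
        hermiteLaw k β {A | ε < |ithLargestEig A i - h i / Real.sqrt (2 * (k:ℝ))|})
      atTop (𝓝 0) := by
  have hk0 : (0:ℝ) < k := by exact_mod_cast hk
  have hc : 0 < (Real.sqrt (2 * (k:ℝ)))⁻¹ := by positivity
  obtain ⟨δ, hδ, hball⟩ : ∃ δ > 0, ∀ A : Matrix (Fin k) (Fin k) ℝ,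
      (∀ i j, |A i j - ((Real.sqrt (2 * (k:ℝ)))⁻¹ • hermiteH k) i j| < δ) →
        ∀ i, |ithLargestEig A i - (Real.sqrt (2 * (k:ℝ)))⁻¹ * h i| ≤ ε := by
    have hev := eventually_abs_ithLargestEig_sub_le ((Real.sqrt (2 * (k:ℝ)))⁻¹ • hermiteH k)
      (fun i => (Real.sqrt (2 * (k:ℝ)))⁻¹ * h i)
      (fun i j hij => mul_lt_mul_of_pos_left (hanti hij) hc)
      (fun i => isRoot_charpoly_smul_hermiteH hk (hroot i) _) hε
    obtain ⟨δ, hδ, hball⟩ := (Metric.eventually_nhds_iff (α := Fin k → Fin k → ℝ)).1 hev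
    refine ⟨δ, hδ, fun A hA => hball ?_⟩
    exact (dist_pi_lt_iff hδ).2 fun i => (dist_pi_lt_iff hδ).2 fun j => hA i j
  have hscale : Tendsto (fun β : ℝ => (Real.sqrt (2 * (k:ℝ) * β))⁻¹) atTop (𝓝 0) :=
    tendsto_inv_atTop_zero.comp
      (Real.tendsto_sqrt_atTop.comp (tendsto_id.const_mul_atTop (by positivity)))
  have hlim := (tendsto_finsetSum Finset.univ
      fun (_ : Fin k) _ => tendsto_gaussianReal_abs_mul_ge hscale hδ).add
    (tendsto_finsetSum Finset.univ
      fun (l : Fin (k - 1)) _ => tendsto_map_chiMeasure_abs_sub_ge hδ l)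
  simp only [Finset.sum_const_zero, add_zero] at hlim
  refine tendsto_of_tendsto_of_tendsto_of_le_of_le' tendsto_const_nhds hlim
    (Eventually.of_forall fun _ => zero_le) ?_
  filter_upwards [eventually_gt_atTop 0] with β hβ
  refine hermiteLaw_le hβ hδ fun A hA => ?_
  by_contra! hcon
  refine (hball A hcon i).not_gt ?_
  rwa [← div_eq_inv_mul]

end
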